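/- arXiv:1707.02847 — 2 statements merged into one kernel-verified Lean document; each statement's English description precedes it below -/
import Mathlib

section
/- For every field F, the F-linear space R_{∂Δ⁵} of permitted colorings of ∂Δ⁵ coincides with the F-linear span of the fifteen edge vectors Ξ_b (b ranging over the 2-element subsets of {1,…,6}), and its dimension over F equals 9. -/
open Finset

/-- The 5×5 integer matrix 𝓡. -/
def Rmat : Matrix (Fin 5) (Fin 5) ℤ :=
  !![0, -2, 1, 1, -2;
     0, -1, 0, 1, -1;
     -1, 2, -2, 0, 1;
     -1, 3, -2, -1, 2;
     0, 1, -1, 0, 0]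

/-- The table of 2-columns ψ for a tetrahedron with (sorted) vertices indexed by `Fin 4`:
for indices a < c, the value of ψ on the edge joining the a-th and the c-th vertex. -/
def psiPair (F : Type*) [Field F] (a c : Fin 4) : F × F :=
  if a = 0 ∧ c = 1 then (-1, 1)
  else if a = 0 ∧ c = 2 then (2, -1)
  else if a = 0 ∧ c = 3 then (-1, 0)
  else if a = 1 ∧ c = 2 then (-1, 0)
  else if a = 1 ∧ c = 3 then (0, 1)
  else if a = 2 ∧ c = 3 then (1, -1)
  else (0, 0)

/-- ψ_{t,b} for a tetrahedron `t` (a 4-element subset of the vertex set) and an edge `b`: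
zero when `b ⊄ t`, and the corresponding table value otherwise. -/
def psi (F : Type*) [Field F] {V : Type*} [LinearOrder V]
    (t : Finset V) (ht : t.card = 4) (b : Finset V) : F × F :=
  ∑ a : Fin 4, ∑ c : Fin 4,
    if a < c ∧ b = {t.orderEmbOfFin ht a, t.orderEmbOfFin ht c} then psiPair F a c else 0

/-- The i-th vertex (in increasing order) of a pentachoron `u`. -/
def pentVert {V : Type*} [LinearOrder V] (u : Finset V) (hu : u.card = 5) (i : Fin 5) : V :=
  u.orderEmbOfFin hu i

/-- The i-th tetrahedral 3-face of a pentachoron `u`: it omits the i-th vertex. -/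
def pentFace {V : Type*} [LinearOrder V] (u : Finset V) (hu : u.card = 5) (i : Fin 5) :
    Finset V :=
  u.erase (pentVert u hu i)

/-- A coloring χ (assigning a pair (x_t, y_t) ∈ F × F to each tetrahedron) is permitted on a
pentachoron `u` if the column of y-values on its five 3-faces equals 𝓡 applied to the column
of x-values. -/
def PermittedOn {V : Type*} [LinearOrder V] {F : Type*} [Field F]
    (u : Finset V) (hu : u.card = 5) (χ : Finset V → F × F) : Prop :=
  ∀ i : Fin 5,
    (χ (pentFace u hu i)).2 = ∑ j : Fin 5, (Rmat i j : F) * (χ (pentFace u hu j)).1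

/-- The coloring assigning ψ_{t,b} to every tetrahedron `t`. -/
def Xi (F : Type*) [Field F] {V : Type*} [LinearOrder V] (b : Finset V) :
    Finset V → F × F :=
  fun t => if ht : t.card = 4 then psi F t ht b else 0


lemma pentFace_card {V : Type*} [LinearOrder V] (u : Finset V) (hu : u.card = 5) (i : Fin 5) :
    (pentFace u hu i).card = 4 := by
  rw [pentFace, pentVert, Finset.card_erase_of_mem (Finset.orderEmbOfFin_mem u hu i), hu]

/-- The tetrahedra of ∂Δ⁵: 4-element subsets of the six vertices. -/
def Tet6 : Type := {t : Finset (Fin 6) // t.card = 4}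

/-- A coloring of ∂Δ⁵, viewed as an element of (F × F)^15, is permitted if on every pentachoron
(5-element subset of vertices) the column of y-values on its five 3-faces equals 𝓡 applied to
the column of x-values. -/
def PermittedT {F : Type*} [Field F] (χ : Tet6 → F × F) : Prop :=
  ∀ (u : Finset (Fin 6)) (hu : u.card = 5) (i : Fin 5),
    (χ ⟨pentFace u hu i, pentFace_card u hu i⟩).2 =
      ∑ j : Fin 5, (Rmat i j : F) * (χ ⟨pentFace u hu j, pentFace_card u hu j⟩).1

/-- The edge vector Ξ_b, assigning ψ_{t,b} to every tetrahedron t of ∂Δ⁵. -/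
def XiFun (F : Type*) [Field F] (b : Finset (Fin 6)) : Tet6 → F × F :=
  fun t => psi F t.1 t.2 b

/-- The tetrahedron spanned by all vertices except `v` and `v.succAbove i`. -/
def tet (v : Fin 6) (i : Fin 5) : Tet6 :=
  ⟨univ.image (v.succAbove ∘ i.succAbove), by
    rw [card_image_of_injective _
      (Fin.succAbove_right_injective.comp Fin.succAbove_right_injective), card_fin]⟩

lemma eq_compl_singleton_of_card_eq_five {u : Finset (Fin 6)} (hu : u.card = 5) :
    ∃ v, u = {v}ᶜ := by
  have h : uᶜ.card = 1 := by simp [card_compl, hu]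
  obtain ⟨v, hv⟩ := card_eq_one.mp h
  exact ⟨v, by rw [← hv, compl_compl]⟩

lemma pentFace_compl_singleton (v : Fin 6) (hu : ({v}ᶜ : Finset (Fin 6)).card = 5) (i : Fin 5) :
    (⟨pentFace {v}ᶜ hu i, pentFace_card _ hu i⟩ : Tet6) = tet v i := by
  have h : v.succAbove i = pentVert {v}ᶜ hu i :=
    congrFun (orderEmbOfFin_unique hu (f := v.succAbove)
      (fun x => by simp [Fin.succAbove_ne]) (Fin.strictMono_succAbove v)) i
  refine Subtype.ext ?_
  simp only [pentFace, ← h, tet]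
  clear h hu
  revert v i
  decide

lemma permittedT_iff {F : Type*} [Field F] (χ : Tet6 → F × F) :
    PermittedT χ ↔ ∀ v i, (χ (tet v i)).2 = ∑ j, (Rmat i j : F) * (χ (tet v j)).1 := by
  constructor
  · intro h v i
    have hv : ({v}ᶜ : Finset (Fin 6)).card = 5 := by simp [card_compl]
    simpa only [pentFace_compl_singleton v hv] using h {v}ᶜ hv i
  · intro h u hu i
    obtain ⟨v, rfl⟩ := eq_compl_singleton_of_card_eq_five hu
    simpa only [pentFace_compl_singleton v hu] using h v i

lemma tet_succ_eq_tet_castSucc : ∀ i j : Fin 5, i ≤ j → tet j.succ i = tet i.castSucc j := by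
  have h : ∀ i j : Fin 5, i ≤ j → (tet j.succ i).1 = (tet i.castSucc j).1 := by decide
  exact fun i j hij => Subtype.ext (h i j hij)

lemma tet_val (v : Fin 6) (i : Fin 5) : (tet v i).1 = {v, v.succAbove i}ᶜ := by
  revert v i
  decide

lemma exists_tet_eq (t : Tet6) : ∃ v i, t = tet v i := by
  have h : (t.1ᶜ).card = 2 := by simp [card_compl, t.2]
  obtain ⟨v, w, hvw, ht⟩ := card_eq_two.mp h
  obtain ⟨i, rfl⟩ := Fin.exists_succAbove_eq hvw.symm
  exact ⟨v, i, Subtype.ext (by rw [tet_val, ← ht, compl_compl])⟩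

/-- The integer version of `psiPair`. -/
def psiPairInt (a c : Fin 4) : ℤ × ℤ :=
  if a = 0 ∧ c = 1 then (-1, 1)
  else if a = 0 ∧ c = 2 then (2, -1)
  else if a = 0 ∧ c = 3 then (-1, 0)
  else if a = 1 ∧ c = 2 then (-1, 0)
  else if a = 1 ∧ c = 3 then (0, 1)
  else if a = 2 ∧ c = 3 then (1, -1)
  else (0, 0)

/-- The integer version of the edge vector `XiFun` of the edge with vertices `p < q`, evaluated
on `tet v i`. -/
def xiInt (p q : Fin 6) (v : Fin 6) (i : Fin 5) : ℤ × ℤ :=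
  ∑ a : Fin 4, ∑ c : Fin 4,
    if a < c ∧ p = v.succAbove (i.succAbove a) ∧ q = v.succAbove (i.succAbove c)
    then psiPairInt a c else 0

lemma psiPair_eq_cast (F : Type*) [Field F] (a c : Fin 4) :
    psiPair F a c = (((psiPairInt a c).1 : F), ((psiPairInt a c).2 : F)) := by
  unfold psiPair psiPairInt
  split_ifs <;> simp

lemma pair_eq_pair_iff_of_lt {α : Type*} [LinearOrder α] {p q x y : α} (h : p < q)
    (h' : x < y) : ({p, q} : Finset α) = {x, y} ↔ p = x ∧ q = y := by
  refine ⟨fun e => ?_, fun ⟨hp, hq⟩ => by rw [hp, hq]⟩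
  have hp : p ∈ ({x, y} : Finset α) := e ▸ mem_insert_self _ _
  have hq : q ∈ ({x, y} : Finset α) := e ▸ mem_insert_of_mem (mem_singleton_self _)
  have hx : x ∈ ({p, q} : Finset α) := e ▸ mem_insert_self _ _
  simp only [mem_insert, mem_singleton] at hp hq hx
  grind

lemma exists_pair_of_card_eq_two {α : Type*} [LinearOrder α] {b : Finset α} (hb : b.card = 2) :
    ∃ p q, p < q ∧ b = {p, q} := by
  obtain ⟨p, q, hpq, rfl⟩ := card_eq_two.mp hb
  rcases hpq.lt_or_gt with h | h
  · exact ⟨p, q, h, rfl⟩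
  · exact ⟨q, p, h, pair_comm p q⟩

lemma xiFun_tet (F : Type*) [Field F] {p q : Fin 6} (hpq : p < q) (v : Fin 6) (i : Fin 5) :
    XiFun F {p, q} (tet v i) = (((xiInt p q v i).1 : F), ((xiInt p q v i).2 : F)) := by
  have h : v.succAbove ∘ i.succAbove = (tet v i).1.orderEmbOfFin (tet v i).2 :=
    orderEmbOfFin_unique _ (fun x => mem_image_of_mem _ (mem_univ x))
      ((Fin.strictMono_succAbove v).comp (Fin.strictMono_succAbove i))
  have h' : ∀ a, (tet v i).1.orderEmbOfFin (tet v i).2 a = v.succAbove (i.succAbove a) :=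
    fun a => (congrFun h a).symm
  have hlt : ∀ {a c : Fin 4}, a < c →
      v.succAbove (i.succAbove a) < v.succAbove (i.succAbove c) := fun hac =>
    Fin.strictMono_succAbove v (Fin.strictMono_succAbove i hac)
  have hiff : ∀ a c : Fin 4, (a < c ∧ ({p, q} : Finset (Fin 6)) =
      {v.succAbove (i.succAbove a), v.succAbove (i.succAbove c)}) ↔
        (a < c ∧ p = v.succAbove (i.succAbove a) ∧ q = v.succAbove (i.succAbove c)) := fun a c =>
    and_congr_right fun hac => pair_eq_pair_iff_of_lt hpq (hlt hac)
  simp only [XiFun, psi, h', hiff, xiInt, psiPair_eq_cast]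
  ext
  · simp only [Prod.fst_sum, Int.cast_sum]
    refine sum_congr rfl fun a _ => sum_congr rfl fun c _ => ?_
    split_ifs <;> simp
  · simp only [Prod.snd_sum, Int.cast_sum]
    refine sum_congr rfl fun a _ => sum_congr rfl fun c _ => ?_
    split_ifs <;> simp

/-- The edge vector of the edge with vertices `p < q` of a pentachoron, on its `i`-th face. -/
def pentXiInt (p q : Fin 5) (i : Fin 5) : ℤ × ℤ :=
  ∑ a : Fin 4, ∑ c : Fin 4,
    if a < c ∧ p = i.succAbove a ∧ q = i.succAbove c then psiPairInt a c else 0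

lemma xiInt_succAbove (p q : Fin 5) (v : Fin 6) (i : Fin 5) :
    xiInt (v.succAbove p) (v.succAbove q) v i = pentXiInt p q i := by
  simp only [xiInt, pentXiInt, Fin.succAbove_right_inj]

lemma xiInt_self_left (q v : Fin 6) (i : Fin 5) : xiInt v q v i = 0 := by
  simp [xiInt, Fin.ne_succAbove]

lemma xiInt_self_right (p v : Fin 6) (i : Fin 5) : xiInt p v v i = 0 := by
  simp [xiInt, Fin.ne_succAbove]

lemma pentXiInt_permitted : ∀ p q : Fin 5, p < q → ∀ i,
    (pentXiInt p q i).2 = ∑ j, Rmat i j * (pentXiInt p q j).1 := by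
  decide +kernel

lemma xiInt_permitted {p q : Fin 6} (hpq : p < q) (v : Fin 6) (i : Fin 5) :
    (xiInt p q v i).2 = ∑ j, Rmat i j * (xiInt p q v j).1 := by
  rcases eq_or_ne p v with rfl | hp
  · simp [xiInt_self_left]
  rcases eq_or_ne q v with rfl | hq
  · simp [xiInt_self_right]
  obtain ⟨p, rfl⟩ := Fin.exists_succAbove_eq hp
  obtain ⟨q, rfl⟩ := Fin.exists_succAbove_eq hq
  simpa only [xiInt_succAbove] using
    pentXiInt_permitted p q ((Fin.strictMono_succAbove v).lt_iff_lt.mp hpq) i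

lemma permittedT_xiFun (F : Type*) [Field F] {b : Finset (Fin 6)} (hb : b.card = 2) :
    PermittedT (XiFun F b) := by
  obtain ⟨p, q, hpq, rfl⟩ := exists_pair_of_card_eq_two hb
  rw [permittedT_iff]
  intro v i
  simp only [xiFun_tet F hpq]
  exact_mod_cast congrArg (Int.cast : ℤ → F) (xiInt_permitted hpq v i)

/-- The space of permitted colorings of ∂Δ⁵. -/
def permittedSubmodule (F : Type*) [Field F] : Submodule F (Tet6 → F × F) where
  carrier := {χ | PermittedT χ}
  zero_mem' := by simp [permittedT_iff]
  add_mem' {χ η} hχ hη := by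
    simp only [Set.mem_ofPred_eq, permittedT_iff, Pi.add_apply, Prod.snd_add, Prod.fst_add,
      mul_add, sum_add_distrib] at *
    intro v i
    rw [hχ, hη]
  smul_mem' c χ hχ := by
    simp only [Set.mem_ofPred_eq, permittedT_iff, Pi.smul_apply, Prod.smul_snd, Prod.smul_fst,
      smul_eq_mul] at *
    intro v i
    rw [hχ, mul_sum]
    exact sum_congr rfl fun j _ => by ring

/-- Indices `(v, i)` of nine tetrahedra `tet v i` whose `x`-values determine a permitted
coloring. -/
def coordIndex : Fin 9 → Fin 6 × Fin 5 :=
  ![(4, 4), (3, 4), (3, 3), (2, 4), (2, 3), (2, 2), (1, 4), (1, 2), (0, 3)]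

/-- Nine edges, as increasing pairs of vertices, whose edge vectors form a basis
of the space of permitted colorings. -/
def basisEdge : Fin 9 → Fin 6 × Fin 6 :=
  ![(0, 3), (0, 4), (1, 3), (1, 4), (1, 5), (2, 5), (3, 4), (3, 5), (4, 5)]

lemma basisEdge_lt : ∀ l, (basisEdge l).1 < (basisEdge l).2 := by
  decide

/-- The `x`-values of the edge vectors of `basisEdge` on the tetrahedra of `coordIndex`. -/
def coordMatrix : Matrix (Fin 9) (Fin 9) ℤ :=
  !![-1, 0, 0, 0, 0, 0, 0, 0, 0;
     0, -1, 0, 0, 0, 0, 0, 0, 0;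
     0, 0, 0, 0, 0, 1, 0, 0, 0;
     2, -1, -1, 0, 0, 0, 1, 0, 0;
     2, 0, -1, 0, 0, 0, 0, 1, 0;
     0, 2, 0, -1, 0, 0, 0, 0, 1;
     2, -1, 0, 0, 0, 0, 1, 0, 0;
     0, 2, 0, 0, 0, 0, 0, 0, 1;
     0, 0, 2, 0, -1, 0, 0, 1, 0]

lemma coordMatrix_eq : coordMatrix = Matrix.of fun k l =>
    (xiInt (basisEdge l).1 (basisEdge l).2 (coordIndex k).1 (coordIndex k).2).1 := by
  decide +kernel

/-- The inverse of `coordMatrix`. -/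
def coordMatrixInv : Matrix (Fin 9) (Fin 9) ℤ :=
  !![-1, 0, 0, 0, 0, 0, 0, 0, 0;
     0, -1, 0, 0, 0, 0, 0, 0, 0;
     0, 0, 0, -1, 0, 0, 1, 0, 0;
     0, 0, 0, 0, 0, -1, 0, 1, 0;
     2, 0, 0, -3, 1, 0, 3, 0, -1;
     0, 0, 1, 0, 0, 0, 0, 0, 0;
     2, -1, 0, 0, 0, 0, 1, 0, 0;
     2, 0, 0, -1, 1, 0, 1, 0, 0;
     0, 2, 0, 0, 0, 0, 0, 1, 0]

lemma coordMatrix_mul_coordMatrixInv : coordMatrix * coordMatrixInv = 1 := by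
  decide +kernel

/-- The `x`-values of a permitted coloring on the tetrahedra of `coordIndex`. -/
def coordMap (F : Type*) [Field F] : permittedSubmodule F →ₗ[F] (Fin 9 → F) where
  toFun χ k := (χ.1 (tet (coordIndex k).1 (coordIndex k).2)).1
  map_add' _ _ := rfl
  map_smul' _ _ := rfl

lemma eq_zero_of_coord_eq_zero {F : Type*} [Field F] {χ : Tet6 → F × F} (hχ : PermittedT χ)
    (h0 : ∀ k, (χ (tet (coordIndex k).1 (coordIndex k).2)).1 = 0) : χ = 0 := by
  rw [permittedT_iff] at hχ
  suffices h : ∀ v i, (χ (tet v i)).1 = 0 by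
    funext t
    obtain ⟨v, i, rfl⟩ := exists_tet_eq t
    exact Prod.ext (h v i) (by simp [hχ v i, h])
  obtain ⟨x, hx⟩ : ∃ x : Fin 6 → Fin 5 → F, ∀ v i, (χ (tet v i)).1 = x v i :=
    ⟨_, fun _ _ => rfl⟩
  have hsymm : ∀ i j : Fin 5, i ≤ j → x j.succ i = x i.castSucc j := fun i j hij => by
    rw [← hx, ← hx, tet_succ_eq_tet_castSucc i j hij]
  have hrel : ∀ i j : Fin 5, i ≤ j →
      ∑ k, (Rmat i k : F) * x j.succ k = ∑ k, (Rmat j k : F) * x i.castSucc k := by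
    intro i j hij
    simp only [← hx, ← hχ]
    rw [tet_succ_eq_tet_castSucc i j hij]
  simp only [hx] at h0 ⊢
  clear hx hχ
  simp [Fin.forall_fin_succ, Fin.sum_univ_succ, Rmat, coordIndex] at h0 hsymm hrel
  simp only [h0, hsymm] at hrel
  simp only [Fin.forall_fin_succ, Fin.forall_fin_zero]
  simp [h0, hsymm]
  grind

lemma coordMap_injective (F : Type*) [Field F] : Function.Injective (coordMap F) := by
  rw [← LinearMap.ker_eq_bot, LinearMap.ker_eq_bot']
  exact fun χ h => Subtype.ext (eq_zero_of_coord_eq_zero χ.2 (congrFun h))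

lemma exists_mem_span_coordMap_eq (F : Type*) [Field F] (z : Fin 9 → F) :
    ∃ χ : permittedSubmodule F,
      χ.1 ∈ Submodule.span F (XiFun F '' {b : Finset (Fin 6) | b.card = 2}) ∧
        coordMap F χ = z := by
  let c := (coordMatrixInv.map (Int.cast : ℤ → F)).mulVec z
  have hcard : ∀ l, ({(basisEdge l).1, (basisEdge l).2} : Finset (Fin 6)).card = 2 := fun l =>
    card_pair (basisEdge_lt l).ne
  let e : Fin 9 → permittedSubmodule F := fun l =>
    ⟨XiFun F {(basisEdge l).1, (basisEdge l).2}, permittedT_xiFun F (hcard l)⟩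
  refine ⟨∑ l, c l • e l, ?_, ?_⟩
  · rw [Submodule.coe_sum]
    exact Submodule.sum_mem _ fun l _ => Submodule.smul_mem _ _
      (Submodule.subset_span ⟨_, hcard l, rfl⟩)
  · have he : ∀ k l, coordMap F (e l) k = coordMatrix.map (Int.cast : ℤ → F) k l := by
      intro k l
      rw [coordMatrix_eq]
      exact congrArg Prod.fst (xiFun_tet F (basisEdge_lt l) _ _)
    have hc : coordMap F (∑ l, c l • e l) = (coordMatrix.map (Int.cast : ℤ → F)).mulVec c := by
      ext k
      simp [Matrix.mulVec, dotProduct, he, mul_comm]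
    have hmul :
        coordMatrix.map (Int.cast : ℤ → F) * coordMatrixInv.map (Int.cast : ℤ → F) = 1 := by
      simpa only [map_mul, map_one, RingHom.mapMatrix_apply, Int.coe_castRingHom] using
        congrArg (Int.castRingHom F).mapMatrix coordMatrix_mul_coordMatrixInv
    rw [hc, Matrix.mulVec_mulVec, hmul, Matrix.one_mulVec]

lemma permittedSubmodule_eq_span (F : Type*) [Field F] :
    permittedSubmodule F = Submodule.span F (XiFun F '' {b : Finset (Fin 6) | b.card = 2}) := by
  refine le_antisymm (fun χ hχ => ?_) (Submodule.span_le.mpr ?_)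
  · obtain ⟨η, hη, h⟩ := exists_mem_span_coordMap_eq F (coordMap F ⟨χ, hχ⟩)
    rwa [coordMap_injective F h] at hη
  · rintro _ ⟨b, hb, rfl⟩
    exact permittedT_xiFun F hb

lemma finrank_permittedSubmodule (F : Type*) [Field F] :
    Module.finrank F (permittedSubmodule F) = 9 := by
  have hsurj : Function.Surjective (coordMap F) := fun z =>
    (exists_mem_span_coordMap_eq F z).imp fun _ h => h.2
  rw [(LinearEquiv.ofBijective (coordMap F) ⟨coordMap_injective F, hsurj⟩).finrank_eq,
    Module.finrank_fin_fun]

/-- for every field F, the space R_{∂Δ⁵} of permitted colorings of ∂Δ⁵ coincides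
with the F-linear span of the fifteen edge vectors Ξ_b, and its dimension over F equals 9. -/
theorem statement2 (F : Type*) [Field F] :
    {χ : Tet6 → F × F | PermittedT χ} =
      ↑(Submodule.span F (XiFun F '' {b : Finset (Fin 6) | b.card = 2})) ∧
    Module.finrank F
      ↥(Submodule.span F (XiFun F '' {b : Finset (Fin 6) | b.card = 2})) = 9 := by
  rw [← permittedSubmodule_eq_span]
  exact ⟨rfl, finrank_permittedSubmodule F⟩
end

section
/- Let F be a field of characteristic 2. For every permitted coloring of ∂Δ⁵, the cocycle sum of the polynomial c(a,b,c,d,e) = ce³+be³+bde²+ace²+b²e²+c³e+b²ce+ac²d+ab²d vanishes: Σ_{i=1}^{6} (−1)^{i−1} c[u_i] = 0 in F, where u_i = {1,…,6}∖{i}. -/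
open Finset

/-- A coloring of ∂Δ⁵ (vertex set `Fin 6`) is permitted if it is permitted on each of the six
pentachora, i.e., on every 5-element subset of the vertices. -/
def Permitted {F : Type*} [Field F] (χ : Finset (Fin 6) → F × F) : Prop :=
  ∀ (u : Finset (Fin 6)) (hu : u.card = 5), PermittedOn u hu χ

lemma card_erase6 (i : Fin 6) : ((univ : Finset (Fin 6)).erase i).card = 5 := by
  rw [Finset.card_erase_of_mem (mem_univ i)]
  simp

/-- `xv F χ i j` is the x-value of the coloring χ on the j-th 3-face (the one omitting the
j-th smallest vertex) of the pentachoron u_i = {1,…,6} ∖ {i} of ∂Δ⁵; for the pentachoron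
u_i this gives the substitutions a = xv i 0, b = xv i 1, c = xv i 2, d = xv i 3,
e = xv i 4. -/
def xv (F : Type*) [Field F] (χ : Finset (Fin 6) → F × F) (i : Fin 6) (j : Fin 5) : F :=
  (χ (pentFace ((univ : Finset (Fin 6)).erase i) (card_erase6 i) j)).1

/-- The face of `univ.erase i` omitting its `j`-th vertex is the complement of an edge. -/
lemma pentFace_univ_erase (i : Fin 6) (j : Fin 5) :
    pentFace (univ.erase i) (card_erase6 i) j = {i, i.succAbove j}ᶜ := by
  have h : i.succAbove = (univ.erase i).orderEmbOfFin (card_erase6 i) :=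
    orderEmbOfFin_unique _ (fun k => by simp) (Fin.strictMono_succAbove i)
  ext v
  simp [pentFace, pentVert, ← h, and_comm]

/-- On the tetrahedron shared by the pentachora omitting `p` and `q`, the two values that
`Rmat` prescribes for the `y`-coordinate agree. -/
lemma Permitted.sum_eq_sum {F : Type*} [Field F] {χ : Finset (Fin 6) → F × F}
    (hχ : Permitted χ) {p q : Fin 6} {i j : Fin 5}
    (hi : p.succAbove i = q) (hj : q.succAbove j = p) :
    ∑ k : Fin 5, (Rmat i k : F) * (χ {p, p.succAbove k}ᶜ).1 =
      ∑ k : Fin 5, (Rmat j k : F) * (χ {q, q.succAbove k}ᶜ).1 := by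
  have hp := hχ _ (card_erase6 p) i
  have hq := hχ _ (card_erase6 q) j
  simp only [pentFace_univ_erase] at hp hq
  rw [← hp, ← hq, hi, hj, Finset.pair_comm]

/-- char 2: the cocycle sum of ce³+be³+bde²+ace²+b²e²+c³e+b²ce+ac²d+ab²d over a permitted coloring of ∂Δ⁵ vanishes. -/
theorem statement13 (F : Type*) [Field F] [CharP F 2]
    (χ : Finset (Fin 6) → F × F) (hχ : Permitted χ) :
    ∑ i : Fin 6, (-1 : F) ^ (i : ℕ) *
      (let a := xv F χ i 0; let b := xv F χ i 1; let c := xv F χ i 2;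
       let d := xv F χ i 3; let e := xv F χ i 4;
       c*e^3 + b*e^3 + b*d*e^2 + a*c*e^2 + b^2*e^2 + c^3*e + b^2*c*e + a*c^2*d + a*b^2*d) = 0 := by
  have h2 : (2 : F) = 0 := CharTwo.two_eq_zero
  have hneg (a : F) : -a = a := CharTwo.neg_eq a
  have hcomm (p q : Fin 6) : (χ {p, q}ᶜ).1 = (χ {q, p}ᶜ).1 := by rw [Finset.pair_comm]
  have h01 := hχ.sum_eq_sum (p := 0) (q := 1) (i := 0) (j := 0) (by decide) (by decide)
  have h02 := hχ.sum_eq_sum (p := 0) (q := 2) (i := 1) (j := 0) (by decide) (by decide)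
  have h03 := hχ.sum_eq_sum (p := 0) (q := 3) (i := 2) (j := 0) (by decide) (by decide)
  have h05 := hχ.sum_eq_sum (p := 0) (q := 5) (i := 4) (j := 0) (by decide) (by decide)
  have h12 := hχ.sum_eq_sum (p := 1) (q := 2) (i := 1) (j := 1) (by decide) (by decide)
  have h14 := hχ.sum_eq_sum (p := 1) (q := 4) (i := 3) (j := 1) (by decide) (by decide)
  simp only [xv, pentFace_univ_erase]
  generalize hx : (fun p q : Fin 6 => (χ {p, q}ᶜ).1) = x
  replace hx (p q : Fin 6) : (χ {p, q}ᶜ).1 = x p q := by rw [← hx]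
  simp only [hx] at h01 h02 h03 h05 h12 h14 hcomm ⊢
  have h3 : (3 : F) = 1 := by linear_combination h2
  simp [Fin.sum_univ_five, Fin.sum_univ_six, Rmat, Fin.succAbove,
    hcomm 1 0, hcomm 2 0, hcomm 2 1, hcomm 3 0, hcomm 3 1, hcomm 3 2,
    hcomm 4 0, hcomm 4 1, hcomm 4 2, hcomm 4 3, hcomm 5 0, hcomm 5 1, hcomm 5 2, hcomm 5 3, hcomm 5 4,
    h2, h3, hneg] at h01 h02 h03 h05 h12 h14 ⊢
  have h14' : x 1 4 = x 0 3 + x 0 4 + x 1 3 := by grind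
  have h24' : x 2 4 = x 0 2 + x 0 4 + x 0 5 + x 2 3 := by grind
  have h34' : x 3 4 = x 0 1 + x 0 5 + x 2 3 := by grind
  have h25' : x 2 5 = x 0 2 + x 0 3 + x 0 5 + x 1 3 + x 1 5 + x 2 3 := by grind
  have h35' : x 3 5 = x 0 5 + x 1 3 + x 1 5 + x 2 3 := by grind
  have h45' : x 4 5 = x 0 5 + x 1 2 + x 2 3 := by grind
  rw [h14', h24', h34', h25', h35', h45']
  grind
end
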